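/- Let G be a simple graph on the vertex set {0, 1, …, n−1} whose edges are pairwise non-crossing: there do not exist edges {a,b} and {c,d} of G with a < c < b < d. If {i,j} is an edge of G whose endpoints have the same parity (i ≡ j mod 2), then no perfect matching of G contains the edge {i,j}. -/

import Mathlib

/-- `M` is a perfect matching of `G`: a set of edges of `G` such that every vertex is
incident to exactly one edge of `M`. -/
def IsPerfectMatching' {V : Type*} (G : SimpleGraph V) (M : Finset (Sym2 V)) : Prop :=
  (∀ e ∈ M, e ∈ G.edgeSet) ∧ ∀ v : V, ∃! e, e ∈ M ∧ v ∈ e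

/-- A finite set that is stable under a fixed-point-free involution has even cardinality. -/
theorem Finset.even_card_of_fixedPointFree_involution {α : Type*} (s : Finset α) (f : α → α)
    (hs : ∀ a ∈ s, f a ∈ s) (hf : ∀ a ∈ s, f (f a) = a) (hne : ∀ a ∈ s, f a ≠ a) :
    Even s.card := by
  have h : ∑ _a ∈ s, (1 : ZMod 2) = 0 :=
    Finset.sum_involution (fun a _ => f a) (fun _ _ => by decide) (fun a ha _ => hne a ha)
      hs hf
  rw [Finset.sum_const, nsmul_one] at h
  exact (ZMod.natCast_eq_zero_iff_even).1 h

/-- A perfect matching determines a map sending each vertex to its partner. -/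
theorem IsPerfectMatching'.exists_partner {V : Type*} {G : SimpleGraph V} {M : Finset (Sym2 V)}
    (hM : IsPerfectMatching' G M) : ∃ f : V → V, ∀ v w, s(v, w) ∈ M ↔ w = f v := by
  have key : ∀ v, ∃ u, ∀ w, s(v, w) ∈ M ↔ w = u := by
    intro v
    obtain ⟨e, ⟨heM, hve⟩, huniq⟩ := hM.2 v
    obtain ⟨u, rfl⟩ := Sym2.mem_iff_exists.1 hve
    refine ⟨u, fun w => ⟨fun hw => ?_, fun hw => hw ▸ heM⟩⟩
    exact Sym2.congr_right.1 (huniq _ ⟨hw, Sym2.mem_mk_left v w⟩)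
  choose f hf using key
  exact ⟨f, hf⟩

/-- In a perfect matching of a non-crossing graph, an edge encloses an even number of vertices. -/
theorem IsPerfectMatching'.even_card_Ioo {V : Type*} [LinearOrder V] [LocallyFiniteOrder V]
    {G : SimpleGraph V} (hnc : ¬ ∃ a b c d : V, G.Adj a b ∧ G.Adj c d ∧ a < c ∧ c < b ∧ b < d)
    {M : Finset (Sym2 V)} (hM : IsPerfectMatching' G M) {i j : V} (hij : s(i, j) ∈ M) :
    Even (Finset.Ioo i j).card := by
  obtain ⟨f, hf⟩ := hM.exists_partner
  have hmem : ∀ v, s(v, f v) ∈ M := fun v => (hf v _).2 rfl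
  have hadj : ∀ v, G.Adj v (f v) := fun v => hM.1 _ (hmem v)
  have hinv : ∀ v, f (f v) = v := fun v => ((hf _ _).1 (Sym2.eq_swap ▸ hmem v)).symm
  obtain rfl := (hf _ _).1 hij
  refine Finset.even_card_of_fixedPointFree_involution _ f (fun k hk => ?_) (fun v _ => hinv v)
    fun v _ => (hadj v).ne'
  rw [Finset.mem_Ioo] at hk ⊢
  constructor
  · rcases lt_trichotomy i (f k) with h | h | h
    · exact h
    · exact absurd (by rw [h, hinv]) hk.2.ne
    · exact (hnc ⟨f k, k, i, f i, (hadj k).symm, hadj i, h, hk.1, hk.2⟩).elim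
  · rcases lt_trichotomy (f k) (f i) with h | h | h
    · exact h
    · exact absurd (by rw [← hinv i, ← h, hinv]) hk.1.ne
    · exact (hnc ⟨i, f i, k, f k, hadj i, hadj k, hk.1, hk.2, h⟩).elim

/-- In a graph on `{0, …, n-1}` whose edges are pairwise non-crossing (no edges `{a,b}`,
`{c,d}` with `a < c < b < d`), an edge whose endpoints have the same parity cannot belong
to any perfect matching. -/
theorem same_parity_edge_not_in_perfect_matching (n : ℕ) (G : SimpleGraph (Fin n))
    (hnc : ¬ ∃ a b c d : Fin n, G.Adj a b ∧ G.Adj c d ∧ a < c ∧ c < b ∧ b < d)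
    (i j : Fin n) (hij : G.Adj i j) (hpar : (i : ℕ) % 2 = (j : ℕ) % 2)
    (M : Finset (Sym2 (Fin n))) (hM : IsPerfectMatching' G M) :
    s(i, j) ∉ M := by
  intro hmem
  wlog hlt : i < j generalizing i j
  · exact this j i hij.symm hpar.symm (Sym2.eq_swap ▸ hmem)
      (lt_of_le_of_ne (not_lt.1 hlt) hij.ne')
  obtain ⟨r, hr⟩ := hM.even_card_Ioo hnc hmem
  rw [Fin.card_Ioo] at hr
  have : (i : ℕ) < j := hlt
  omega
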